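/- Let A be a unital Banach algebra, 0 < ε < 1/20, N ≥ 1, and e ∈ A with ‖e² − e‖ < ε, ‖e‖ ≤ N, ‖1 − e‖ ≤ N. Let κ₀(e) = (1/2πi)∮_{|z−1|=√ε} (z − e)⁻¹ dz be the spectral idempotent. Then ‖κ₀(e) − e‖ < 2(N+1)ε/((1 − √ε)(1 − 2√ε)) and ‖κ₀(e)‖ < (N+1)/(1 − 2√ε). -/

import Mathlib

open scoped Real

open Metric in
/-- Termwise integration over a circle under a uniform summable bound. -/
theorem hasSum_circleIntegral_of_summable_norm {E : Type*} [NormedAddCommGroup E] [NormedSpace ℂ E]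
    {c : ℂ} {R : ℝ} (hR : 0 ≤ R) {F : ℕ → ℂ → E} {f : ℂ → E} {u : ℕ → ℝ}
    (hF : ∀ n, ContinuousOn (F n) (sphere c R)) (hu : Summable u)
    (hbound : ∀ n, ∀ z ∈ sphere c R, ‖F n z‖ ≤ u n)
    (hsum : ∀ z ∈ sphere c R, HasSum (fun n => F n z) (f z)) :
    HasSum (fun n => ∮ z in C(c, R), F n z) (∮ z in C(c, R), f z) := by
  have hmem (θ : ℝ) : circleMap c R θ ∈ sphere c R := circleMap_mem_sphere c hR θ
  refine intervalIntegral.hasSum_integral_of_dominated_convergence (fun n _ => R * u n)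
    (fun n => ?_) (fun n => ?_) ?_ ?_ ?_
  · exact ((hF n).circleIntegrable hR).out.def'.1
  · refine .of_forall fun θ _ => ?_
    rw [norm_smul]
    have : ‖deriv (circleMap c R) θ‖ = R := by simp [abs_of_nonneg hR]
    rw [this]
    exact mul_le_mul_of_nonneg_left (hbound n _ (hmem θ)) hR
  · exact .of_forall fun _ _ => hu.mul_left R
  · exact intervalIntegrable_const
  · exact .of_forall fun θ _ => (hsum _ (hmem θ)).const_smul _

theorem norm_pow_mul_le_of_normedRing {A : Type*} [NormedRing A] (a x : A) (n : ℕ) :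
    ‖a ^ n * x‖ ≤ ‖a‖ ^ n * ‖x‖ := by
  induction n with
  | zero => simp
  | succ n ih =>
    rw [pow_succ', pow_succ', mul_assoc, mul_assoc]
    exact (norm_mul_le _ _).trans (mul_le_mul_of_nonneg_left ih (norm_nonneg _))

/-- The residue at `1` of `(z * (z - 1)) ^ (-(k + 1))`, as a circle integral. -/
noncomputable def quadResidue (t : ℝ) (k : ℕ) : ℂ :=
  (2 * (π : ℂ) * Complex.I)⁻¹ * ∮ z in C(1, t), (z * (z - 1))⁻¹ ^ (k + 1)

section Circle

open Metric

variable {t : ℝ} {z : ℂ}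

theorem norm_mul_sub_one_ge (ht : 0 < t) (hz : z ∈ sphere (1 : ℂ) t) :
    t * (1 - t) ≤ ‖z * (z - 1)‖ := by
  have h1 : ‖z - 1‖ = t := by simpa [dist_eq_norm] using hz
  have h2 : 1 - t ≤ ‖z‖ := by
    have := norm_sub_norm_le (1 : ℂ) (1 - z)
    rw [norm_sub_rev 1 z, h1] at this
    simpa using this
  rw [norm_mul, h1, mul_comm]
  exact mul_le_mul_of_nonneg_right h2 ht.le

theorem mul_sub_one_ne_zero (ht : 0 < t) (ht1 : t < 1) (hz : z ∈ sphere (1 : ℂ) t) :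
    z * (z - 1) ≠ 0 :=
  norm_pos_iff.1 <| (mul_pos ht (sub_pos.2 ht1)).trans_le (norm_mul_sub_one_ge ht hz)

theorem continuousOn_inv_mul_sub_one_pow (ht : 0 < t) (ht1 : t < 1) (k : ℕ) :
    ContinuousOn (fun z : ℂ => (z * (z - 1))⁻¹ ^ k) (sphere 1 t) :=
  (ContinuousOn.inv₀ (by fun_prop) fun _ hz => mul_sub_one_ne_zero ht ht1 hz).pow k

theorem circleIntegral_inv_eq_zero (ht : 0 < t) (ht1 : t < 1) :
    (∮ z in C(1, t), z⁻¹ : ℂ) = 0 := by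
  have hne (z : ℂ) (hz : z ∈ closedBall (1 : ℂ) t) : z ≠ 0 := by
    rintro rfl
    simp at hz
    linarith
  refine Complex.circleIntegral_eq_zero_of_differentiable_on_off_countable ht.le
    Set.countable_empty (continuousOn_id.inv₀ hne) fun z hz => ?_
  exact differentiableAt_inv (hne z (ball_subset_closedBall hz.1))

theorem circleIntegrable_inv (ht : 0 < t) (ht1 : t < 1) :
    CircleIntegrable (fun z : ℂ => z⁻¹) 1 t :=
  (continuousOn_id.inv₀ fun _ hz =>
    left_ne_zero_of_mul (mul_sub_one_ne_zero ht ht1 hz)).circleIntegrable ht.le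

theorem circleIntegrable_sub_one_inv (ht : 0 < t) (ht1 : t < 1) :
    CircleIntegrable (fun z : ℂ => (z - 1)⁻¹) 1 t :=
  (ContinuousOn.inv₀ (by fun_prop) fun _ hz =>
    right_ne_zero_of_mul (mul_sub_one_ne_zero ht ht1 hz)).circleIntegrable ht.le

theorem quadResidue_zero (ht : 0 < t) (ht1 : t < 1) : quadResidue t 0 = 1 := by
  have h : (∮ z in C(1, t), (z * (z - 1))⁻¹ ^ (0 + 1) : ℂ)
      = ∮ z in C(1, t), ((z - 1)⁻¹ - z⁻¹) := by
    refine circleIntegral.integral_congr ht.le fun z hz => ?_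
    have h := mul_sub_one_ne_zero ht ht1 hz
    have h1 := left_ne_zero_of_mul h
    have h2 := right_ne_zero_of_mul h
    rw [zero_add, pow_one]
    field_simp
    ring
  rw [quadResidue, h, circleIntegral.integral_sub (circleIntegrable_sub_one_inv ht ht1)
    (circleIntegrable_inv ht ht1), circleIntegral_inv_eq_zero ht ht1,
    circleIntegral.integral_sub_center_inv _ ht.ne', sub_zero,
    inv_mul_cancel₀ Complex.two_pi_I_ne_zero]

theorem circleIntegral_inv_mul_sub_half (ht : 0 < t) (ht1 : t < 1) :
    (∮ z in C(1, t), (z * (z - 1))⁻¹ ^ (0 + 1) * (z - 1 / 2) : ℂ) =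
      2 * π * Complex.I * (1 / 2) := by
  have h : (∮ z in C(1, t), (z * (z - 1))⁻¹ ^ (0 + 1) * (z - 1 / 2) : ℂ)
      = ∮ z in C(1, t), (1 / 2 : ℂ) * ((z - 1)⁻¹ + z⁻¹) := by
    refine circleIntegral.integral_congr ht.le fun z hz => ?_
    have h := mul_sub_one_ne_zero ht ht1 hz
    have h1 := left_ne_zero_of_mul h
    have h2 := right_ne_zero_of_mul h
    rw [zero_add, pow_one]
    field_simp
    ring
  rw [h, circleIntegral.integral_const_mul, circleIntegral.integral_add
    (circleIntegrable_sub_one_inv ht ht1) (circleIntegrable_inv ht ht1),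
    circleIntegral_inv_eq_zero ht ht1, circleIntegral.integral_sub_center_inv _ ht.ne', add_zero,
    mul_comm]

theorem hasDerivAt_inv_mul_sub_one_pow (hz : z * (z - 1) ≠ 0) (k : ℕ) :
    HasDerivAt (fun z : ℂ => (z * (z - 1))⁻¹ ^ (k + 1))
      (-(k + 1) * ((z * (z - 1))⁻¹ ^ (k + 2) * (2 * z - 1))) z := by
  have h : HasDerivAt (fun z : ℂ => z * (z - 1)) (2 * z - 1) z := by
    refine ((hasDerivAt_id z).mul ((hasDerivAt_id z).sub_const 1)).congr_deriv ?_
    simp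
    ring
  refine ((h.inv hz).pow (k + 1)).congr_deriv ?_
  simp only [Pi.inv_apply, Nat.add_sub_cancel, Nat.cast_add, Nat.cast_one, div_eq_mul_inv,
    ← inv_pow]
  ring

theorem circleIntegral_inv_pow_mul_sub_half (ht : 0 < t) (ht1 : t < 1) (k : ℕ) :
    (∮ z in C(1, t), (z * (z - 1))⁻¹ ^ (k + 2) * (z - 1 / 2) : ℂ) = 0 := by
  refine circleIntegral.integral_eq_zero_of_hasDerivWithinAt
    (f := fun z => -(1 / (2 * (k + 1))) * (z * (z - 1))⁻¹ ^ (k + 1)) ht.le fun z hz => ?_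
  refine (((hasDerivAt_inv_mul_sub_one_pow (mul_sub_one_ne_zero ht ht1 hz) k).const_mul
    _).congr_deriv ?_).hasDerivWithinAt
  have : (k + 1 : ℂ) ≠ 0 := by exact_mod_cast k.succ_ne_zero
  field_simp

/-- The recursion satisfied by the (signed) central binomial coefficients. -/
theorem quadResidue_succ (ht : 0 < t) (ht1 : t < 1) (k : ℕ) :
    (k + 1) * quadResidue t (k + 1) = -(4 * k + 2) * quadResidue t k := by
  have hint (j : ℕ) : CircleIntegrable (fun z : ℂ => (z * (z - 1))⁻¹ ^ j) 1 t :=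
    (continuousOn_inv_mul_sub_one_pow ht ht1 j).circleIntegrable ht.le
  have h : (∮ z in C(1, t), ((-(4 * k + 2) : ℂ) * (z * (z - 1))⁻¹ ^ (k + 1) -
      (k + 1) * (z * (z - 1))⁻¹ ^ (k + 2)) : ℂ) = 0 := by
    refine circleIntegral.integral_eq_zero_of_hasDerivWithinAt
      (f := fun z => (2 * z - 1) * (z * (z - 1))⁻¹ ^ (k + 1)) ht.le fun z hz => ?_
    have hz' := mul_sub_one_ne_zero ht ht1 hz
    have hlin : HasDerivAt (fun z : ℂ => 2 * z - 1) 2 z := by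
      simpa using ((hasDerivAt_id z).const_mul 2).sub_const 1
    refine ((hlin.mul (hasDerivAt_inv_mul_sub_one_pow hz' k)).congr_deriv ?_).hasDerivWithinAt
    have hq : (z * (z - 1))⁻¹ ^ (k + 1) = (z * (z - 1))⁻¹ ^ (k + 2) * (z * (z - 1)) := by
      rw [pow_succ _ (k + 1), mul_assoc, inv_mul_cancel₀ hz', mul_one]
    rw [hq]
    ring
  have hc (c : ℂ) (j : ℕ) : CircleIntegrable (fun z : ℂ => c * (z * (z - 1))⁻¹ ^ j) 1 t :=
    (hint j).const_smul (a := c)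
  rw [circleIntegral.integral_sub (hc _ _) (hc _ _), circleIntegral.integral_const_mul,
    circleIntegral.integral_const_mul] at h
  unfold quadResidue
  linear_combination (-(2 * (π : ℂ) * Complex.I)⁻¹) * h

theorem norm_quadResidue_succ_le (ht : 0 < t) (ht1 : t < 1) (k : ℕ) :
    ‖quadResidue t (k + 1)‖ ≤ 2 * 4 ^ k := by
  have hstep (k : ℕ) : (k + 1) * ‖quadResidue t (k + 1)‖ = (4 * k + 2) * ‖quadResidue t k‖ := by
    have h := congrArg norm (quadResidue_succ ht ht1 k)
    have h1 : ‖(k + 1 : ℂ)‖ = k + 1 := by exact_mod_cast Complex.norm_natCast (k + 1)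
    have h2 : ‖(4 * k + 2 : ℂ)‖ = 4 * k + 2 := by exact_mod_cast Complex.norm_natCast (4 * k + 2)
    rwa [norm_mul, norm_mul, norm_neg, h1, h2] at h
  induction k with
  | zero => simpa [quadResidue_zero ht ht1] using (hstep 0).le
  | succ k ih =>
    have h := hstep (k + 1)
    push_cast at h
    have hk : (0 : ℝ) ≤ k := k.cast_nonneg
    rw [pow_succ]
    nlinarith [norm_nonneg (quadResidue t (k + 1))]

end Circle

section Resolvent

variable {A : Type*} [NormedRing A] [NormedAlgebra ℂ A]

theorem mul_resolvent_factor (e : A) (z : ℂ) :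
    (algebraMap ℂ A z - e) * (algebraMap ℂ A (z - 1) + e) =
      algebraMap ℂ A (z * (z - 1)) - (e ^ 2 - e) := by
  have h := Algebra.commutes z e
  simp only [map_mul, map_sub, map_one, mul_add, sub_mul, mul_sub, mul_one, ← h, pow_two]
  abel

theorem resolvent_factor_mul (e : A) (z : ℂ) :
    (algebraMap ℂ A (z - 1) + e) * (algebraMap ℂ A z - e) =
      algebraMap ℂ A (z * (z - 1)) - (e ^ 2 - e) := by
  have h := Algebra.commutes z e
  simp only [map_mul, map_sub, map_one, add_mul, sub_mul, mul_sub, mul_one, one_mul, ← h, pow_two]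
  abel

/-- The resolvent of `e` as a power series in `e ^ 2 - e`. -/
theorem hasSum_inverse_sub [CompleteSpace A] (e : A) {z : ℂ} (hz : ‖e ^ 2 - e‖ < ‖z * (z - 1)‖) :
    HasSum (fun n : ℕ => (z * (z - 1))⁻¹ ^ (n + 1) •
      ((e ^ 2 - e) ^ n * (algebraMap ℂ A (z - 1) + e)))
      (Ring.inverse (algebraMap ℂ A z - e)) := by
  have hq : z * (z - 1) ≠ 0 := norm_pos_iff.1 ((norm_nonneg _).trans_lt hz)
  have hl := resolvent_factor_mul e z
  have hr := mul_resolvent_factor e z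
  set q := z * (z - 1)
  set a := e ^ 2 - e
  set y := algebraMap ℂ A (z - 1) + e
  have hx : ‖q⁻¹ • a‖ < 1 := by
    rw [norm_smul, norm_inv, inv_mul_lt_iff₀ (norm_pos_iff.2 hq), mul_one]
    exact hz
  have hfac : q⁻¹ • (algebraMap ℂ A q - a) = 1 - q⁻¹ • a := by
    rw [smul_sub, Algebra.algebraMap_eq_smul_one, smul_smul, inv_mul_cancel₀ hq, one_smul]
  set S := ∑' n : ℕ, (q⁻¹ • a) ^ n
  have hS : HasSum (fun n : ℕ => (q⁻¹ • a) ^ n) S :=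
    (summable_geometric_of_norm_lt_one hx).hasSum
  have hleft : (q⁻¹ • (S * y)) * (algebraMap ℂ A z - e) = 1 := by
    rw [smul_mul_assoc, mul_assoc, hl, ← mul_smul_comm, hfac, geom_series_mul_neg _ hx]
  have hright : (algebraMap ℂ A z - e) * (q⁻¹ • (y * S)) = 1 := by
    rw [mul_smul_comm, ← mul_assoc, hr, ← smul_mul_assoc, hfac, mul_neg_geom_series _ hx]
  have heq := left_inv_eq_right_inv hleft hright
  let v : Aˣ := ⟨algebraMap ℂ A z - e, q⁻¹ • (S * y), heq ▸ hright, hleft⟩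
  have hinv : Ring.inverse (algebraMap ℂ A z - e) = q⁻¹ • (S * y) := Ring.inverse_unit v
  rw [hinv]
  convert! (hS.mul_right y).const_smul q⁻¹ using 2 with n
  rw [smul_pow, smul_mul_assoc, smul_smul, pow_succ']

end Resolvent

section Idempotent

open Metric

variable {A : Type*} [NormedRing A] [NormedAlgebra ℂ A] [CompleteSpace A]

theorem circleIntegral_resolvent_term (e : A) {t : ℝ} (ht : 0 < t) (ht1 : t < 1) (n : ℕ) :
    (∮ z in C(1, t), (z * (z - 1))⁻¹ ^ (n + 1) •
      ((e ^ 2 - e) ^ n * (algebraMap ℂ A (z - 1) + e))) =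
    (∮ z in C(1, t), (z * (z - 1))⁻¹ ^ (n + 1) * (z - 1 / 2)) • (e ^ 2 - e) ^ n +
    (∮ z in C(1, t), (z * (z - 1))⁻¹ ^ (n + 1)) •
      ((e ^ 2 - e) ^ n * (e - algebraMap ℂ A (1 / 2))) := by
  have hc := continuousOn_inv_mul_sub_one_pow ht ht1 (n + 1)
  rw [← circleIntegral.integral_smul_const, ← circleIntegral.integral_smul_const,
    ← circleIntegral.integral_add]
  · congr 1
    funext z
    have : algebraMap ℂ A (z - 1) + e =
        algebraMap ℂ A (z - 1 / 2) + (e - algebraMap ℂ A (1 / 2)) := by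
      rw [add_sub, add_sub_right_comm, ← map_sub]
      congr 2
      ring
    rw [this, mul_add, smul_add, mul_smul, ← Algebra.commutes, ← Algebra.smul_def]
  · exact ContinuousOn.circleIntegrable ht.le
      ((hc.mul (by fun_prop)).smul continuousOn_const)
  · exact ContinuousOn.circleIntegrable ht.le (hc.smul continuousOn_const)

theorem hasSum_circleIntegral_resolvent (e : A) {t : ℝ} (ht : 0 < t) (ht1 : t < 1)
    (he : ‖e ^ 2 - e‖ < t * (1 - t)) :
    HasSum (fun n : ℕ => ∮ z in C(1, t), (z * (z - 1))⁻¹ ^ (n + 1) •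
      ((e ^ 2 - e) ^ n * (algebraMap ℂ A (z - 1) + e)))
      (∮ z in C(1, t), Ring.inverse (algebraMap ℂ A z - e)) := by
  set m := t * (1 - t)
  have hm : 0 < m := mul_pos ht (sub_pos.2 ht1)
  refine hasSum_circleIntegral_of_summable_norm ht.le
    (u := fun n => (‖e ^ 2 - e‖ / m) ^ n * (m⁻¹ * (t * ‖(1 : A)‖ + ‖e‖))) (fun n => ?_) ?_
    (fun n z hz => ?_) (fun z hz => hasSum_inverse_sub e (he.trans_le (norm_mul_sub_one_ge ht hz)))
  · refine (continuousOn_inv_mul_sub_one_pow ht ht1 (n + 1)).smul (Continuous.continuousOn ?_)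
    have := continuous_algebraMap ℂ A
    fun_prop
  · exact (summable_geometric_of_lt_one (by positivity) ((div_lt_one hm).2 he)).mul_right _
  · have h1 : ‖(z * (z - 1))⁻¹ ^ (n + 1)‖ ≤ m⁻¹ ^ (n + 1) := by
      rw [norm_pow, norm_inv]
      have := norm_mul_sub_one_ge ht hz
      gcongr
    have h2 : ‖algebraMap ℂ A (z - 1) + e‖ ≤ t * ‖(1 : A)‖ + ‖e‖ := by
      refine (norm_add_le _ _).trans (add_le_add_left ?_ _)
      rw [norm_algebraMap, ← dist_eq_norm, mem_sphere.1 hz]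
    rw [norm_smul]
    calc _ ≤ m⁻¹ ^ (n + 1) * (‖e ^ 2 - e‖ ^ n * (t * ‖(1 : A)‖ + ‖e‖)) :=
          mul_le_mul h1 ((norm_pow_mul_le_of_normedRing _ _ n).trans
            (mul_le_mul_of_nonneg_left h2 (by positivity))) (norm_nonneg _) (by positivity)
      _ = _ := by rw [div_pow, inv_pow, pow_succ]; field_simp

/-- The spectral idempotent differs from `e` by a binomial series in `e ^ 2 - e`. -/
theorem hasSum_spectral_idempotent_sub (e : A) {t : ℝ} (ht : 0 < t) (ht1 : t < 1)
    (he : ‖e ^ 2 - e‖ < t * (1 - t)) :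
    HasSum (fun n : ℕ => quadResidue t (n + 1) •
      ((e ^ 2 - e) ^ (n + 1) * (e - algebraMap ℂ A (1 / 2))))
      ((2 * (π : ℂ) * Complex.I)⁻¹ •
        (∮ z in C(1, t), Ring.inverse (algebraMap ℂ A z - e)) - e) := by
  have h := (hasSum_circleIntegral_resolvent e ht ht1 he).const_smul (2 * (π : ℂ) * Complex.I)⁻¹
  rw [← hasSum_nat_add_iff' 1] at h
  convert! h using 1
  · funext n
    rw [circleIntegral_resolvent_term e ht ht1, circleIntegral_inv_pow_mul_sub_half ht ht1,
      zero_smul, zero_add, smul_smul, quadResidue]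
  · have h0 := quadResidue_zero ht ht1
    rw [quadResidue] at h0
    rw [Finset.sum_range_one, circleIntegral_resolvent_term e ht ht1,
      circleIntegral_inv_mul_sub_half ht ht1, smul_add, smul_smul, smul_smul, h0,
      inv_mul_cancel_left₀ Complex.two_pi_I_ne_zero, pow_zero, one_smul, one_mul,
      ← Algebra.algebraMap_eq_smul_one, add_sub_cancel]

theorem norm_spectral_idempotent_sub_le (e : A) {t ε M : ℝ} (ht : 0 < t) (ht1 : t < 1)
    (he : ‖e ^ 2 - e‖ < t * (1 - t)) (heε : ‖e ^ 2 - e‖ ≤ ε) (hε : 4 * ε < 1)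
    (hM : ‖e - algebraMap ℂ A (1 / 2)‖ ≤ M) :
    ‖(2 * (π : ℂ) * Complex.I)⁻¹ •
      (∮ z in C(1, t), Ring.inverse (algebraMap ℂ A z - e)) - e‖ ≤ 2 * ε * M / (1 - 4 * ε) := by
  have hε0 : 0 ≤ ε := (norm_nonneg _).trans heε
  rw [← (hasSum_spectral_idempotent_sub e ht ht1 he).tsum_eq, div_eq_mul_inv]
  refine tsum_of_norm_bounded
    ((hasSum_geometric_of_lt_one (by positivity) hε).mul_left (2 * ε * M)) fun n => ?_
  rw [norm_smul]
  calc _ ≤ (2 * 4 ^ n) * (ε ^ (n + 1) * M) := by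
        refine mul_le_mul (norm_quadResidue_succ_le ht ht1 n)
          ((norm_pow_mul_le_of_normedRing _ _ _).trans ?_) (norm_nonneg _) (by positivity)
        exact mul_le_mul (pow_le_pow_left₀ (norm_nonneg _) heε _) hM (norm_nonneg _) (by positivity)
    _ = _ := by rw [mul_pow]; ring

end Idempotent

/-- For a quasi-idempotent `e`, the spectral idempotent
`κ₀(e) = (1/(2πi)) ∮_{|z-1|=√ε} (z - e)⁻¹ dz` satisfies
`‖κ₀(e) - e‖ < 2(N+1)ε / ((1-√ε)(1-2√ε))` and `‖κ₀(e)‖ < (N+1)/(1-2√ε)`. -/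
theorem stmt_12 {A : Type*} [NormedRing A] [NormedAlgebra ℂ A] [CompleteSpace A]
    (e : A) (ε N : ℝ) (hε0 : 0 < ε) (hε : ε < 1 / 20) (hN : 1 ≤ N)
    (he : ‖e ^ 2 - e‖ < ε) (heN : ‖e‖ ≤ N) (heN' : ‖1 - e‖ ≤ N)
    (κ : A)
    (hκ : κ = ((2 * (π : ℂ) * Complex.I)⁻¹) •
      circleIntegral (fun z => Ring.inverse (algebraMap ℂ A z - e)) 1 (Real.sqrt ε)) :
    ‖κ - e‖ < 2 * (N + 1) * ε / ((1 - Real.sqrt ε) * (1 - 2 * Real.sqrt ε)) ∧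
    ‖κ‖ < (N + 1) / (1 - 2 * Real.sqrt ε) := by
  have ht : 0 < √ε := Real.sqrt_pos.2 hε0
  have hsq : √ε ^ 2 = ε := Real.sq_sqrt hε0.le
  have ht4 : √ε < 1 / 4 := by
    rw [Real.sqrt_lt' (by norm_num)]
    linarith
  set t := √ε
  have hhalf : ‖e - algebraMap ℂ A (1 / 2)‖ ≤ N := by
    have h : e - algebraMap ℂ A (1 / 2) = (1 / 2 : ℂ) • (e - (1 - e)) := by
      rw [Algebra.algebraMap_eq_smul_one]
      module
    have h2 := norm_sub_le e (1 - e)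
    rw [h, norm_smul]
    norm_num
    linarith
  have key : ‖κ - e‖ ≤ 2 * ε * N / (1 - 4 * ε) := by
    rw [hκ]
    exact norm_spectral_idempotent_sub_le e ht (by linarith) (by nlinarith) he.le (by linarith) hhalf
  refine ⟨key.trans_lt ?_, ?_⟩
  · rw [div_lt_div_iff₀ (by linarith) (mul_pos (by linarith) (by linarith)), ← hsq]
    have h1 : (1 - t) * (1 - 2 * t) ≤ 1 - 4 * t ^ 2 := by nlinarith
    have h2 : 0 < 1 - 4 * t ^ 2 := by nlinarith
    calc 2 * t ^ 2 * N * ((1 - t) * (1 - 2 * t)) ≤ 2 * t ^ 2 * N * (1 - 4 * t ^ 2) := by gcongr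
      _ < 2 * (N + 1) * t ^ 2 * (1 - 4 * t ^ 2) := by
        gcongr ?_ * _
        nlinarith [pow_pos ht 2]
  · have h1 : ‖κ‖ ≤ 2 * ε * N / (1 - 4 * ε) + N := by
      have := norm_add_le (κ - e) e
      rw [sub_add_cancel] at this
      linarith
    refine h1.trans_lt ?_
    have h2 : 1 - 4 * ε = (1 - 2 * t) * (1 + 2 * t) := by rw [← hsq]; ring
    have h3 : 2 * ε * N / (1 - 4 * ε) ≤ 2 * ε * N / (1 - 2 * t) := by
      refine div_le_div_of_nonneg_left (by positivity) (by linarith) ?_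
      nlinarith
    have h4 : 2 * ε * N / (1 - 2 * t) + N < (N + 1) / (1 - 2 * t) := by
      rw [div_add' _ _ _ (by linarith), div_lt_div_iff_of_pos_right (by linarith), ← hsq]
      nlinarith [mul_pos ht (show 0 < N by linarith)]
    linarith
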